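/- Let V be a finite-dimensional real vector space and Ω an alternating 2-form on V of rank p, i.e. the p-fold wedge power Ω^{∧p} ≠ 0 while Ω^{∧(p+1)} = 0. If β is a nonzero alternating l-form on V with Ω ∧ β = 0, then l ≥ p. -/

import Mathlib

set_option synthInstance.maxHeartbeats 1000000
set_option maxHeartbeats 1000000

namespace ExteriorAlgebra

open CliffordAlgebra (contractLeft)

section CommRing

variable {R M : Type*} [CommRing R] [AddCommGroup M] [Module R M]

theorem contractLeft_ι_mul (d : Module.Dual R M) (a : M) (x : ExteriorAlgebra R M) :
    contractLeft (Q := (0 : QuadraticForm R M)) d (ι R a * x) =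
      d a • x - ι R a * contractLeft (Q := (0 : QuadraticForm R M)) d x :=
  CliffordAlgebra.contractLeft_ι_mul d a x

/-- The interior product lowers the degree by one. -/
theorem contractLeft_mem_exteriorPower (d : Module.Dual R M) {n : ℕ} {x : ExteriorAlgebra R M}
    (hx : x ∈ ⋀[R]^(n + 1) M) :
    contractLeft (Q := (0 : QuadraticForm R M)) d x ∈ ⋀[R]^n M := by
  induction n generalizing x with
  | zero =>
    rw [zero_add, exteriorPower, pow_one] at hx
    obtain ⟨a, rfl⟩ := hx
    rw [exteriorPower, pow_zero, ι, CliffordAlgebra.contractLeft_ι]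
    exact Submodule.algebraMap_mem _
  | succ n ih =>
    rw [exteriorPower, pow_succ'] at hx
    induction hx using Submodule.mul_induction_on' with
    | mem_mul_mem y hy x hx =>
      obtain ⟨a, rfl⟩ := hy
      rw [contractLeft_ι_mul]
      refine Submodule.sub_mem _ (Submodule.smul_mem _ _ hx) ?_
      rw [exteriorPower, pow_succ']
      exact Submodule.mul_mem_mul (LinearMap.mem_range_self _ _) (ih hx)
    | add x _ y _ hx hy =>
      rw [map_add]
      exact Submodule.add_mem _ hx hy

/-- Euler's formula for the degree of an exterior form. -/
theorem sum_ι_mul_contractLeft_coord {I : Type*} [Fintype I] (b : Module.Basis I R M) {n : ℕ}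
    {x : ExteriorAlgebra R M} (hx : x ∈ ⋀[R]^n M) :
    ∑ i, ι R (b i) * contractLeft (Q := (0 : QuadraticForm R M)) (b.coord i) x = n • x := by
  induction n generalizing x with
  | zero =>
    rw [exteriorPower, pow_zero] at hx
    obtain ⟨r, rfl⟩ := Submodule.mem_one.mp hx
    rw [zero_smul]
    refine Finset.sum_eq_zero fun i _ => ?_
    rw [CliffordAlgebra.contractLeft_algebraMap, mul_zero]
  | succ n ih =>
    rw [exteriorPower, pow_succ'] at hx
    induction hx using Submodule.mul_induction_on' with
    | mem_mul_mem y hy x hx =>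
      obtain ⟨a, rfl⟩ := hy
      have anticomm (i : I) (z : ExteriorAlgebra R M) :
          ι R (b i) * (ι R a * z) = -(ι R a * (ι R (b i) * z)) := by
        rw [← mul_assoc, ← mul_assoc, ← neg_mul, eq_neg_of_add_eq_zero_left (ι_add_mul_swap _ _)]
      have repr : ∑ i, b.coord i a • ι R (b i) = ι R a := by
        conv_rhs => rw [← b.sum_repr a, map_sum]
        simp
      calc ∑ i, ι R (b i) * contractLeft (Q := (0 : QuadraticForm R M)) (b.coord i) (ι R a * x)
          = (∑ i, b.coord i a • ι R (b i)) * x + ι R a * ∑ i, ι R (b i) *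
              contractLeft (Q := (0 : QuadraticForm R M)) (b.coord i) x := by
            rw [Finset.sum_mul, Finset.mul_sum, ← Finset.sum_add_distrib]
            refine Finset.sum_congr rfl fun i _ => ?_
            rw [contractLeft_ι_mul, mul_sub, anticomm, sub_neg_eq_add, mul_smul_comm,
              smul_mul_assoc]
        _ = (n + 1) • (ι R a * x) := by
            rw [repr, ih hx, mul_smul_comm, add_smul, one_smul, add_comm]
    | add x _ y _ hx hy =>
      simp only [map_add, mul_add, Finset.sum_add_distrib, smul_add, hx, hy]

/-- Forms of degree two are central. -/
theorem commute_of_mem_exteriorPower_two {ω : ExteriorAlgebra R M} (hω : ω ∈ ⋀[R]^2 M)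
    (x : ExteriorAlgebra R M) : Commute ω x := by
  rw [exteriorPower, pow_two] at hω
  induction hω using Submodule.mul_induction_on' with
  | mem_mul_mem y hy z hz =>
    obtain ⟨a, rfl⟩ := hy
    obtain ⟨b, rfl⟩ := hz
    induction x using ExteriorAlgebra.induction with
    | algebraMap r => exact (Algebra.commutes r _).symm
    | ι c =>
      have swap (u v : M) : ι R u * ι R v = -(ι R v * ι R u) :=
        eq_neg_of_add_eq_zero_left (ι_add_mul_swap u v)
      rw [commute_iff_eq, mul_assoc, swap b c, mul_neg, ← mul_assoc, swap a c, neg_mul, neg_neg,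
        mul_assoc]
    | mul x y hx hy => exact hx.mul_right hy
    | add x y hx hy => exact hx.add_right hy
  | add y _ z _ hy hz => exact hy.add_left hz

/-- The interior product satisfies the Leibniz rule on products with a form of degree two. -/
theorem contractLeft_mul_of_mem_exteriorPower_two (d : Module.Dual R M)
    {ω : ExteriorAlgebra R M} (hω : ω ∈ ⋀[R]^2 M) (x : ExteriorAlgebra R M) :
    contractLeft (Q := (0 : QuadraticForm R M)) d (ω * x) =
      contractLeft (Q := (0 : QuadraticForm R M)) d ω * x +
        ω * contractLeft (Q := (0 : QuadraticForm R M)) d x := by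
  rw [exteriorPower, pow_two] at hω
  induction hω using Submodule.mul_induction_on' with
  | mem_mul_mem y hy z hz =>
    obtain ⟨a, rfl⟩ := hy
    obtain ⟨b, rfl⟩ := hz
    have hb : contractLeft (Q := (0 : QuadraticForm R M)) d (ι R b) = algebraMap R _ (d b) :=
      CliffordAlgebra.contractLeft_ι 0 d b
    rw [mul_assoc, contractLeft_ι_mul, contractLeft_ι_mul, contractLeft_ι_mul, hb,
      ← Algebra.commutes, ← Algebra.smul_def]
    simp only [mul_sub, sub_mul, smul_mul_assoc, mul_smul_comm, mul_assoc]
    abel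
  | add y _ z _ hy hz =>
    simp only [add_mul, map_add, hy, hz]
    abel

theorem pow_succ_mul_contractLeft_eq_zero (d : Module.Dual R M) {ω : ExteriorAlgebra R M}
    (hω : ω ∈ ⋀[R]^2 M) {k : ℕ} {x : ExteriorAlgebra R M} (h : ω ^ k * x = 0) :
    ω ^ (k + 1) * contractLeft (Q := (0 : QuadraticForm R M)) d x = 0 := by
  induction k generalizing x with
  | zero =>
    rw [pow_zero, one_mul] at h
    rw [h, map_zero, mul_zero]
  | succ k ih =>
    have key := ih (x := ω * x) (by rw [← mul_assoc, ← pow_succ, h])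
    rw [contractLeft_mul_of_mem_exteriorPower_two d hω, mul_add, ← mul_assoc,
      ((commute_of_mem_exteriorPower_two hω _).pow_left (k + 1)).eq, mul_assoc, h, mul_zero,
      zero_add, ← mul_assoc, ← pow_succ] at key
    exact key

end CommRing

variable {K M : Type*} [Field K] [CharZero K] [AddCommGroup M] [Module K M]
  [FiniteDimensional K M]

theorem exists_contractLeft_ne_zero {n : ℕ} {x : ExteriorAlgebra K M}
    (hx : x ∈ ⋀[K]^(n + 1) M) (hx0 : x ≠ 0) :
    ∃ d : Module.Dual K M, contractLeft (Q := (0 : QuadraticForm K M)) d x ≠ 0 := by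
  by_contra! h
  have key := sum_ι_mul_contractLeft_coord (Module.finBasis K M) hx
  simp only [h, mul_zero, Finset.sum_const_zero] at key
  rw [← Nat.cast_smul_eq_nsmul K] at key
  exact (smul_ne_zero (Nat.cast_ne_zero.mpr n.succ_ne_zero) hx0) key.symm

/-- If a power of a form of degree two annihilates a nonzero form of degree `l`, then raising
the exponent by `l` gives zero. -/
theorem pow_add_eq_zero_of_pow_mul_eq_zero {ω : ExteriorAlgebra K M} (hω : ω ∈ ⋀[K]^2 M)
    {k l : ℕ} {x : ExteriorAlgebra K M} (hx : x ∈ ⋀[K]^l M) (hx0 : x ≠ 0)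
    (h : ω ^ k * x = 0) : ω ^ (k + l) = 0 := by
  induction l generalizing k x with
  | zero =>
    rw [exteriorPower, pow_zero] at hx
    obtain ⟨r, rfl⟩ := Submodule.mem_one.mp hx
    have hr : r ≠ 0 := by
      rintro rfl
      exact hx0 (map_zero _)
    rw [← Algebra.commutes, ← Algebra.smul_def] at h
    exact (smul_eq_zero.mp h).resolve_left hr
  | succ l ih =>
    obtain ⟨d, hd⟩ := exists_contractLeft_ne_zero hx hx0
    rw [← add_assoc, add_right_comm]
    exact ih (contractLeft_mem_exteriorPower d hx) hd (pow_succ_mul_contractLeft_eq_zero d hω h)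

end ExteriorAlgebra

/-!
STATEMENT 1: If `Ω` is an alternating 2-form of rank `p` (i.e. `Ω^p ≠ 0`, `Ω^(p+1) = 0`) on a
finite-dimensional real vector space `V` and `β` is a nonzero `l`-form with `Ω ∧ β = 0`,
then `l ≥ p`.  Forms of degree `k` are modelled as elements of the `k`-th exterior power
`⋀[ℝ]^k (V^*)` of the dual space, with the wedge product given by multiplication in the
exterior algebra.
-/
theorem statement1 (V : Type*) [AddCommGroup V] [Module ℝ V] [FiniteDimensional ℝ V]
    (p l : ℕ) (Ω : ⋀[ℝ]^2 (Module.Dual ℝ V))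
    (hp : (Ω : ExteriorAlgebra ℝ (Module.Dual ℝ V)) ^ p ≠ 0)
    (hp' : (Ω : ExteriorAlgebra ℝ (Module.Dual ℝ V)) ^ (p + 1) = 0)
    (β : ⋀[ℝ]^l (Module.Dual ℝ V)) (hβ : β ≠ 0)
    (h : (Ω : ExteriorAlgebra ℝ (Module.Dual ℝ V)) * (β : ExteriorAlgebra ℝ (Module.Dual ℝ V))
      = 0) :
    p ≤ l := by
  by_contra! hlt
  have key := ExteriorAlgebra.pow_add_eq_zero_of_pow_mul_eq_zero Ω.2 (k := 1) β.2
    (by simpa using hβ) (by rwa [pow_one])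
  exact hp (pow_eq_zero_of_le (by omega) key)
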